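/- For every r ≥ 1 and every f ∈ Λ̄, the (r+1)-fold iterated commutator satisfies ad(M_f)^{r+1}(L^{(r)}) = 0, where M_f is the operator of multiplication by f on Λ̄ and ad(M_f)(T) = M_f∘T − T∘M_f; in other words, L^{(r)} is a differential operator of order at most r on Λ̄. -/

import Mathlib

open Polynomial MvPolynomial

noncomputable section

/-- Λ̄ = ℂ[p₀,p₁,…] -/
abbrev Lam : Type := MvPolynomial ℕ ℂ
/-- Λ̄[x] -/
abbrev LamX : Type := Polynomial Lam

/-- the derivation on coefficients: p_l ↦ l·x^{l-1} -/
def coeffDer : Derivation ℂ Lam LamX :=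
  MvPolynomial.mkDerivation ℂ (fun l => (l : LamX) * Polynomial.X ^ (l - 1))

/-- ∂ : the ℂ-derivation of Λ̄[x] with ∂x = 1, ∂p_l = l x^{l-1}. -/
def pd (f : LamX) : LamX :=
  Polynomial.derivative f + f.sum (fun i c => coeffDer c * Polynomial.X ^ i)

/-- Δ(x^l). -/
def Dvals (l : ℕ) : LamX :=
  if l = 0 then 0 else
    (∑ j ∈ Finset.range l, Polynomial.X ^ (l - 1 - j) * Polynomial.C (MvPolynomial.X j))
      - (l : LamX) * Polynomial.X ^ (l - 1)

/-- Δ : Λ̄-linear, Δ(x^l f) = Δ(x^l)·f. -/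
def Del (f : LamX) : LamX := f.sum (fun l c => Polynomial.C c * Dvals l)

/-- Dunkl operator at infinity, D_k = ∂ − kΔ. -/
def Dk (k : ℂ) (f : LamX) : LamX := pd f - k • Del f

/-- E : Λ̄[x] → Λ̄, x^l f ↦ p_l f. -/
def E (f : LamX) : Lam := f.sum (fun l c => c * MvPolynomial.X l)

/-- L^{(r)} = E ∘ D_k^r restricted to Λ̄. -/
def Lr (k : ℂ) (r : ℕ) (f : Lam) : Lam := E ((Dk k)^[r] (Polynomial.C f))

end

theorem pd_add (g h : LamX) : pd (g + h) = pd g + pd h := by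
  unfold pd
  rw [Polynomial.sum_add_index _ _ _ (by simp) (by simp [add_mul]), Polynomial.derivative_add]
  abel

theorem Del_add (g h : LamX) : Del (g + h) = Del g + Del h :=
  Polynomial.sum_add_index _ _ _ (by simp) (by simp [add_mul])

theorem E_add (g h : LamX) : E (g + h) = E g + E h :=
  Polynomial.sum_add_index _ _ _ (by simp) (by simp [add_mul])

theorem pd_monomial (n : ℕ) (c : Lam) :
    pd (Polynomial.monomial n c) =
      Polynomial.derivative (Polynomial.monomial n c) + coeffDer c * Polynomial.X ^ n := by
  unfold pd
  rw [Polynomial.sum_monomial_index _ _ (by simp)]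

theorem pd_C_mul (f : Lam) (g : LamX) :
    pd (Polynomial.C f * g) = Polynomial.C f * pd g + coeffDer f * g := by
  induction g using Polynomial.induction_on' with
  | add p q hp hq => rw [mul_add, pd_add, pd_add, hp, hq]; ring
  | monomial n c =>
    rw [Polynomial.C_mul_monomial, pd_monomial, pd_monomial, Derivation.leibniz,
      ← Polynomial.C_mul_monomial, Polynomial.derivative_C_mul, ← Polynomial.C_mul_X_pow_eq_monomial]
    simp only [Polynomial.smul_eq_C_mul]
    ring

theorem Del_C_mul (f : Lam) (g : LamX) : Del (Polynomial.C f * g) = Polynomial.C f * Del g := by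
  unfold Del
  rw [← Polynomial.smul_eq_C_mul, Polynomial.sum_smul_index _ _ _ (by simp)]
  simp only [Polynomial.sum_def, Finset.mul_sum, Polynomial.C_mul, mul_assoc]

theorem E_C_mul (f : Lam) (g : LamX) : E (Polynomial.C f * g) = f * E g := by
  unfold E
  rw [← Polynomial.smul_eq_C_mul, Polynomial.sum_smul_index _ _ _ (by simp)]
  simp only [Polynomial.sum_def, Finset.mul_sum, mul_assoc]

theorem Dk_add (k : ℂ) (g h : LamX) : Dk k (g + h) = Dk k g + Dk k h := by
  unfold Dk
  rw [pd_add, Del_add, smul_add]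
  abel

theorem Dk_C_mul (k : ℂ) (f : Lam) (g : LamX) :
    Dk k (Polynomial.C f * g) = Polynomial.C f * Dk k g + coeffDer f * g := by
  unfold Dk
  rw [pd_C_mul, Del_C_mul, mul_sub, mul_smul_comm]
  abel

/-- The inner derivation `T ↦ a * T - T * a` of a ring, as an additive map. -/
def innerDer {R : Type*} [Ring R] (a : R) : R →+ R :=
  AddMonoidHom.mulLeft a - AddMonoidHom.mulRight a

theorem innerDer_apply {R : Type*} [Ring R] (a T : R) : innerDer a T = a * T - T * a := rfl

theorem innerDer_mul {R : Type*} [Ring R] (a S T : R) :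
    innerDer a (S * T) = innerDer a S * T + S * innerDer a T := by
  simp only [innerDer_apply]
  noncomm_ring

theorem innerDer_iterate_mul_eq_zero {R : Type*} [Ring R] (a : R) :
    ∀ (m n : ℕ) (S T : R), (innerDer a)^[m] S = 0 → (innerDer a)^[n] T = 0 →
      (innerDer a)^[m + n - 1] (S * T) = 0
  | 0, n, S, T, hS, _ => by
    obtain rfl : S = 0 := hS
    rw [zero_mul, iterate_map_zero]
  | m, 0, S, T, _, hT => by
    obtain rfl : T = 0 := hT
    rw [mul_zero, iterate_map_zero]
  | m + 1, n + 1, S, T, hS, hT => by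
    have hl := innerDer_iterate_mul_eq_zero a m (n + 1) (innerDer a S) T hS hT
    have hr := innerDer_iterate_mul_eq_zero a (m + 1) n S (innerDer a T) hS hT
    rw [show m + (n + 1) - 1 = m + n by lia] at hl
    rw [show m + 1 + n - 1 = m + n by lia] at hr
    rw [show m + 1 + (n + 1) - 1 = (m + n) + 1 by lia, Function.iterate_succ_apply,
      innerDer_mul, iterate_map_add, hl, hr, add_zero]
termination_by m n => m + n

theorem innerDer_iterate_pow_eq_zero {R : Type*} [Ring R] {a D : R}
    (h : (innerDer a)^[2] D = 0) (r : ℕ) : (innerDer a)^[r + 1] (D ^ r) = 0 := by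
  induction r with
  | zero => simp [innerDer_apply]
  | succ r ih => rw [pow_succ]; exact innerDer_iterate_mul_eq_zero a (r + 1) 2 _ _ ih h

/-- Multiplication by `p` on `Λ̄[x]`. -/
noncomputable def mulEnd (p : LamX) : AddMonoid.End LamX := AddMonoidHom.mulLeft p

/-- The Dunkl operator at infinity as an additive endomorphism. -/
noncomputable def DkEnd (k : ℂ) : AddMonoid.End LamX := AddMonoidHom.mk' (Dk k) (Dk_add k)

theorem innerDer_DkEnd (k : ℂ) (f : Lam) :
    innerDer (mulEnd (Polynomial.C f)) (DkEnd k) =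
      -mulEnd (coeffDer f) := by
  ext1 g
  change Polynomial.C f * Dk k g - Dk k (Polynomial.C f * g) = -(coeffDer f * g)
  rw [Dk_C_mul]
  abel

theorem innerDer_iterate_two_DkEnd (k : ℂ) (f : Lam) :
    (innerDer (mulEnd (Polynomial.C f)))^[2] (DkEnd k) = 0 := by
  rw [Function.iterate_succ_apply, Function.iterate_one, innerDer_DkEnd]
  ext1 g
  change Polynomial.C f * -(coeffDer f * g) - -(coeffDer f * (Polynomial.C f * g)) = 0
  ring

/-- Restriction of an endomorphism of `Λ̄[x]` to `Λ̄`, followed by `E`. -/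
noncomputable def compressE (T : AddMonoid.End LamX) : Lam → Lam := fun g => E (T (Polynomial.C g))

theorem compressE_semiconj (f : Lam) :
    Function.Semiconj compressE
      (innerDer (mulEnd (Polynomial.C f)))
      (fun T : Lam → Lam => (fun g => f * T g) - (fun g => T (f * g))) := by
  intro T
  funext g
  have h := E_add (Polynomial.C f * T (Polynomial.C g) - T (Polynomial.C f * Polynomial.C g))
    (T (Polynomial.C f * Polynomial.C g))
  rw [sub_add_cancel, E_C_mul] at h
  change E (Polynomial.C f * T (Polynomial.C g) - T (Polynomial.C f * Polynomial.C g)) =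
    f * E (T (Polynomial.C g)) - E (T (Polynomial.C (f * g)))
  rw [Polynomial.C_mul, h, add_sub_cancel_right]

theorem compressE_DkEnd_pow (k : ℂ) (r : ℕ) : compressE (DkEnd k ^ r) = Lr k r := by
  funext g
  change E ((DkEnd k ^ r) (Polynomial.C g)) = _
  rw [AddMonoid.End.coe_pow]
  rfl

/-- ad(M_f)^{r+1}(L^{(r)}) = 0, i.e. L^{(r)} is a differential operator
of order at most r on Λ̄.  Here M_f is multiplication by f and
ad(M_f)(T) = M_f ∘ T − T ∘ M_f. -/
theorem Lr_is_differential_operator_of_order_r (k : ℂ) (r : ℕ) (hr : 1 ≤ r) (f : Lam) :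
    (fun T : Lam → Lam => (fun g => f * T g) - (fun g => T (f * g)))^[r + 1]
        (Lr k r) = 0 := by
  rw [← compressE_DkEnd_pow, ← (compressE_semiconj f).iterate_right (r + 1),
    innerDer_iterate_pow_eq_zero (innerDer_iterate_two_DkEnd k f)]
  funext g
  change E 0 = 0
  simp [E]
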